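/- arXiv:1510.00530 — 2 statements merged into one kernel-verified Lean document; each statement's English description precedes it below -/
import Mathlib

section
/- Let K be a field of characteristic ≠ 2, 𝔤 = sl₂(K) regarded as a Lie ring, and V a quadratic 𝔤-module. Then V = ker ρ(h) ⊕ ker(ρ(h) − id) ⊕ ker(ρ(h) + id); moreover ker ρ(h) = Ann_V(𝔤), ker(ρ(h) − id) = ρ(e)·V (the image of ρ(e)), and ker(ρ(h) + id) = ρ(f)·V. -/
/-!
STATEMENT 10: Let K be a field of characteristic ≠ 2, 𝔤 = sl₂(K) regarded as a Lie ring,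
and V a quadratic 𝔤-module.  Then V = ker ρ(h) ⊕ ker(ρ(h) − id) ⊕ ker(ρ(h) + id);
moreover ker ρ(h) = Ann_V(𝔤), ker(ρ(h) − id) = ρ(e)·V and ker(ρ(h) + id) = ρ(f)·V.
-/

open LieAlgebra.SpecialLinear

noncomputable section

/-- `sl₂(K)`, the trace-zero 2×2 matrices over `K`, as a Lie ring. -/
abbrev sl2 (K : Type*) [Field K] := LieAlgebra.SpecialLinear.sl (Fin 2) K

/-- `e = E₁₂`. -/
def sl2e (K : Type*) [Field K] : sl2 K := single 0 1 (by decide) 1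

/-- `f = E₂₁`. -/
def sl2f (K : Type*) [Field K] : sl2 K := single 1 0 (by decide) 1

/-- `h = E₁₁ − E₂₂`. -/
def sl2h (K : Type*) [Field K] : sl2 K :=
  ⟨!![1, 0; 0, -1], LinearMap.mem_ker.mpr (by simp [Matrix.trace_fin_two])⟩

/-- `Ann_V(𝔤) = {v ∈ V : ρ(x)v = 0 for all x ∈ 𝔤}`. -/
def annV (K V : Type*) [Field K] [AddCommGroup V] (ρ : sl2 K →+ AddMonoid.End V) :
    AddSubgroup V where
  carrier := {v | ∀ x : sl2 K, ρ x v = 0}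
  zero_mem' := by intro x; simp
  add_mem' := by intro a b ha hb x; rw [map_add, ha, hb, add_zero]
  neg_mem' := by intro a ha x; rw [map_neg, ha, neg_zero]

/-- An `sl₂`-triple of additive families in a ring with `E lam * E mu = 0` satisfies
`H 1 * E mu = E mu`. -/
theorem quadratic_h_mul_e {K R : Type*} [Field K] [Ring R] (h2 : (2 : K) ≠ 0) (E F H : K →+ R)
    (hEF : ∀ a b, E a * F b - F b * E a = H (a * b))
    (hHE : ∀ a b, H a * E b - E b * H a = E (a * b) + E (a * b))
    (hEE : ∀ a b, E a * E b = 0) (mu : K) : H 1 * E mu = E mu := by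
  have key : ∀ c, H 1 * E c + H 1 * E c = E c + E c := by
    intro c
    rcases eq_or_ne c 0 with rfl | hc
    · simp
    have hH : H 1 = E c * F c⁻¹ - F c⁻¹ * E c := by rw [hEF, mul_inv_cancel₀ hc]
    have hl : H 1 * E c = E c * F c⁻¹ * E c := by
      rw [hH, sub_mul, mul_assoc (F _), hEE, mul_zero, sub_zero]
    have hr : E c * H 1 = -(E c * F c⁻¹ * E c) := by
      rw [hH, mul_sub, ← mul_assoc, ← mul_assoc, hEE, zero_mul, zero_sub]
    have := hHE 1 c
    rwa [hr, hl, one_mul, sub_neg_eq_add, ← hl] at this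
  have hmu : mu = mu / 2 + mu / 2 := by field_simp; norm_num
  rw [hmu, map_add, mul_add, key]

/-- An `sl₂`-triple of additive families in a ring with `E lam * E mu = 0` satisfies
`E mu * H 1 = -E mu`. -/
theorem quadratic_e_mul_h {K R : Type*} [Field K] [Ring R] (h2 : (2 : K) ≠ 0) (E F H : K →+ R)
    (hEF : ∀ a b, E a * F b - F b * E a = H (a * b))
    (hHE : ∀ a b, H a * E b - E b * H a = E (a * b) + E (a * b))
    (hEE : ∀ a b, E a * E b = 0) (mu : K) : E mu * H 1 = -E mu := by
  have h := hHE 1 mu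
  rw [quadratic_h_mul_e h2 E F H hEF hHE hEE, one_mul] at h
  rw [sub_eq_iff_eq_add] at h
  rw [eq_neg_iff_add_eq_zero, add_comm]
  apply add_left_cancel (a := E mu)
  rw [add_zero, ← add_assoc]
  exact h.symm

/-- The additive family `a ↦ ρ (a • x)`. -/
def smulFamily {K V : Type*} [Field K] [AddCommGroup V] (ρ : sl2 K →+ AddMonoid.End V)
    (x : sl2 K) : K →+ AddMonoid.End V where
  toFun a := ρ (a • x)
  map_zero' := by simp
  map_add' a b := by rw [add_smul, map_add]

theorem coe_sl2e {K : Type*} [Field K] : (sl2e K : Matrix (Fin 2) (Fin 2) K) = !![0, 1; 0, 0] := by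
  ext i j
  fin_cases i <;> fin_cases j <;> simp only [sl2e, val_single] <;> simp

theorem coe_sl2f {K : Type*} [Field K] : (sl2f K : Matrix (Fin 2) (Fin 2) K) = !![0, 0; 1, 0] := by
  ext i j
  fin_cases i <;> fin_cases j <;> simp only [sl2f, val_single] <;> simp

theorem lie_smul_e_smul_f {K : Type*} [Field K] (a b : K) :
    ⁅a • sl2e K, b • sl2f K⁆ = (a * b) • sl2h K := by
  apply Subtype.ext
  ext i j
  fin_cases i <;> fin_cases j <;>
    simp [coe_sl2e, coe_sl2f, sl2h, Ring.lie_def, mul_comm]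

theorem lie_smul_h_smul_e {K : Type*} [Field K] (a b : K) :
    ⁅a • sl2h K, b • sl2e K⁆ = (a * b) • sl2e K + (a * b) • sl2e K := by
  apply Subtype.ext
  ext i j
  fin_cases i <;> fin_cases j <;>
    simp [coe_sl2e, sl2h, Ring.lie_def]
  ring

theorem lie_smul_h_smul_f {K : Type*} [Field K] (a b : K) :
    ⁅a • sl2h K, b • sl2f K⁆ = -((a * b) • sl2f K + (a * b) • sl2f K) := by
  apply Subtype.ext
  ext i j
  fin_cases i <;> fin_cases j <;>
    simp [coe_sl2f, sl2h, Ring.lie_def]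
  ring

theorem sl2_eq_smul_add {K : Type*} [Field K] (x : sl2 K) :
    x = x.1 0 1 • sl2e K + x.1 1 0 • sl2f K + x.1 0 0 • sl2h K := by
  have hx : x.1 0 0 + x.1 1 1 = 0 := by
    have := LinearMap.mem_ker.mp x.2
    simpa [Matrix.trace_fin_two] using this
  apply Subtype.ext
  ext i j
  fin_cases i <;> fin_cases j <;>
    simp [coe_sl2e, coe_sl2f, sl2h]
  linear_combination hx

theorem stmt10 (K V : Type*) [Field K] (hchar : ringChar K ≠ 2) [AddCommGroup V]
    (ρ : sl2 K →+ AddMonoid.End V)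
    (hbracket : ∀ x y : sl2 K, ρ ⁅x, y⁆ = ρ x * ρ y - ρ y * ρ x)
    (hquadE : ∀ lam mu : K, ρ (lam • sl2e K) * ρ (mu • sl2e K) = 0)
    (hquadF : ∀ lam mu : K, ρ (lam • sl2f K) * ρ (mu • sl2f K) = 0) :
    -- the three kernels
    ∀ (A B C : AddSubgroup V),
      A = AddMonoidHom.ker (ρ (sl2h K) : V →+ V) →
      B = AddMonoidHom.ker ((ρ (sl2h K) - 1 : AddMonoid.End V) : V →+ V) →
      C = AddMonoidHom.ker ((ρ (sl2h K) + 1 : AddMonoid.End V) : V →+ V) →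
      -- V = A ⊕ B ⊕ C (internal direct sum)
      (Disjoint A B ∧ Disjoint (A ⊔ B) C ∧ A ⊔ B ⊔ C = (⊤ : AddSubgroup V)) ∧
      -- identification of the three summands
      A = annV K V ρ ∧
      B = AddMonoidHom.range (ρ (sl2e K) : V →+ V) ∧
      C = AddMonoidHom.range (ρ (sl2f K) : V →+ V) := by
  have h2 : (2 : K) ≠ 0 := Ring.two_ne_zero hchar
  have : NeZero (2 : K) := ⟨h2⟩
  let E := smulFamily ρ (sl2e K)
  let F := smulFamily ρ (sl2f K)
  let H := smulFamily ρ (sl2h K)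
  have hEF : ∀ a b, E a * F b - F b * E a = H (a * b) := fun a b => by
    change ρ _ * ρ _ - ρ _ * ρ _ = ρ _
    rw [← hbracket, lie_smul_e_smul_f]
  have hHE : ∀ a b, H a * E b - E b * H a = E (a * b) + E (a * b) := fun a b => by
    change ρ _ * ρ _ - ρ _ * ρ _ = ρ _ + ρ _
    rw [← hbracket, lie_smul_h_smul_e, map_add]
  have hHF : ∀ a b, H a * F b - F b * H a = -(F (a * b) + F (a * b)) := fun a b => by
    change ρ _ * ρ _ - ρ _ * ρ _ = -(ρ _ + ρ _)
    rw [← hbracket, lie_smul_h_smul_f, map_neg, map_add]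
  have hFE : ∀ a b, F a * E b - E b * F a = (-H) (a * b) := fun a b => by
    rw [AddMonoidHom.neg_apply, mul_comm, ← hEF, neg_sub]
  have hHF' : ∀ a b, (-H) a * F b - F b * (-H) a = F (a * b) + F (a * b) := fun a b => by
    rw [AddMonoidHom.neg_apply, neg_mul, mul_neg, ← neg_inj, ← hHF]
    abel
  have he : ρ (sl2e K) = E 1 := congrArg ρ (one_smul K _).symm
  have hf : ρ (sl2f K) = F 1 := congrArg ρ (one_smul K _).symm
  have hh : ρ (sl2h K) = H 1 := congrArg ρ (one_smul K _).symm
  have he_left (a : K) (v : V) : H 1 (E a v) = E a v :=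
    DFunLike.congr_fun (quadratic_h_mul_e h2 E F H hEF hHE hquadE a) v
  have he_right (a : K) (v : V) : E a (H 1 v) = -E a v :=
    DFunLike.congr_fun (quadratic_e_mul_h h2 E F H hEF hHE hquadE a) v
  have hf_left (a : K) (v : V) : H 1 (F a v) = -F a v :=
    neg_eq_iff_eq_neg.mp (DFunLike.congr_fun (quadratic_h_mul_e h2 F E (-H) hFE hHF' hquadF a) v)
  have hf_right (a : K) (v : V) : F a (H 1 v) = F a v := by
    have := DFunLike.congr_fun (quadratic_e_mul_h h2 F E (-H) hFE hHF' hquadF a) v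
    rw [AddMonoidHom.neg_apply, mul_neg] at this
    exact neg_injective this
  have hh_apply (a : K) (v : V) : H a v = E a (F 1 v) - F 1 (E a v) := by
    have := DFunLike.congr_fun (hEF a 1) v
    rw [mul_one] at this
    exact this.symm
  have hhh (a : K) (v : V) : H a (H 1 v) = E a (F 1 v) + F 1 (E a v) := by
    rw [hh_apply, hf_right, he_right, map_neg, sub_neg_eq_add]
  have double (G : K →+ AddMonoid.End V) (v : V) : G 1 v = G (1 / 2) v + G (1 / 2) v := by
    change G 1 v = (G (1 / 2) + G (1 / 2)) v
    rw [← map_add, add_halves]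
  rintro A B C hA hB hC
  have memA (v : V) : v ∈ A ↔ H 1 v = 0 := by rw [hA, hh]; exact AddMonoidHom.mem_ker
  have memB (v : V) : v ∈ B ↔ H 1 v = v := by
    rw [hB, hh]; exact AddMonoidHom.mem_ker.trans sub_eq_zero
  have memC (v : V) : v ∈ C ↔ H 1 v = -v := by
    rw [hC, hh]; exact AddMonoidHom.mem_ker.trans add_eq_zero_iff_eq_neg
  have eB (a : K) (v : V) : E a v ∈ B := (memB _).2 (he_left a v)
  have fC (a : K) (v : V) : F a v ∈ C := (memC _).2 (hf_left a v)
  have e_zero (v : V) (hv : v ∈ B) : E 1 v = 0 := by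
    have := he_right (1 / 2) v
    rw [(memB v).1 hv, eq_neg_iff_add_eq_zero, ← double] at this
    exact this
  have f_zero (v : V) (hv : v ∈ C) : F 1 v = 0 := by
    have := hf_right (1 / 2) v
    rw [(memC v).1 hv, map_neg, neg_eq_iff_add_eq_zero, ← double] at this
    exact this
  have b_eq (v : V) (hv : v ∈ B) : v = E 1 (F 1 v) := by
    have := hh_apply 1 v
    rwa [e_zero v hv, map_zero, sub_zero, (memB v).1 hv] at this
  have c_eq (v : V) (hv : v ∈ C) : v = F 1 (E 1 v) := by
    have := hh_apply 1 v
    rwa [f_zero v hv, map_zero, zero_sub, (memC v).1 hv, neg_inj] at this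
  refine ⟨⟨?_, ?_, ?_⟩, ?_, ?_, ?_⟩
  · rw [AddSubgroup.disjoint_def]
    intro v ha hb
    rw [← (memB v).1 hb, (memA v).1 ha]
  · rw [AddSubgroup.disjoint_def]
    intro v hab hc
    obtain ⟨a, ha, b, hb, rfl⟩ := AddSubgroup.mem_sup.1 hab
    have h1 := (memC _).1 hc
    rw [map_add, (memA a).1 ha, (memB b).1 hb, zero_add] at h1
    have h3 : b + b = 0 := by
      have := congrArg (H 1) h1
      rw [map_neg, map_add, (memA a).1 ha, (memB b).1 hb, zero_add] at this
      exact eq_neg_iff_add_eq_zero.1 this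
    have h4 : b = 0 := by
      rw [b_eq b hb, double, ← map_add, ← map_add, h3, map_zero, map_zero]
    rw [h4] at h1
    rw [h4, ← neg_eq_zero, ← h1]
  · rw [eq_top_iff]
    intro v _
    have hv : v = (v - H 1 (H 1 v)) + E 1 (F 1 v) + F 1 (E 1 v) := by
      rw [hhh]; abel
    rw [hv]
    refine AddSubgroup.add_mem_sup (AddSubgroup.add_mem_sup ?_ (eB _ _)) (fC _ _)
    rw [memA, hhh, map_sub, map_add, he_left, hf_left, hh_apply]
    abel
  · ext v
    rw [memA]
    refine ⟨fun hv x => ?_, fun hv => hv _ ▸ by rw [hh]⟩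
    have hev (a : K) : E a v = 0 := by
      rw [← neg_eq_zero, ← he_right, hv, map_zero]
    have hfv (a : K) : F a v = 0 := by
      rw [← hf_right, hv, map_zero]
    have hhv (a : K) : H a v = 0 := by
      rw [hh_apply, hfv, hev, map_zero, map_zero, sub_zero]
    rw [sl2_eq_smul_add x, map_add, map_add]
    change E _ v + F _ v + H _ v = 0
    rw [hev, hfv, hhv, add_zero, add_zero]
  · ext v
    rw [he]
    exact ⟨fun hv => ⟨_, (b_eq v hv).symm⟩, by rintro ⟨w, rfl⟩; exact eB 1 w⟩
  · ext v
    rw [hf]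
    exact ⟨fun hv => ⟨_, (c_eq v hv).symm⟩, by rintro ⟨w, rfl⟩; exact fC 1 w⟩
end
end

section
/- Let K be a field of characteristic ≠ 2, 𝔤 = sl₂(K) regarded as a Lie ring, and V a quadratic 𝔤-module. Then for all λ, λ' ∈ K and every v ∈ V with ρ(h)v = v: ρ(λh)(ρ(λ'h)v) = ρ((λλ')h)v. (So on the subgroup {v : ρ(h)v = v}, the assignment λ·v := ρ(λh)v is multiplicative in λ.) -/
/-!
STATEMENT 13: Let K be a field of characteristic ≠ 2, 𝔤 = sl₂(K) regarded as a Lie ring,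
and V a quadratic 𝔤-module.  Then for all λ, λ' ∈ K and every v ∈ V with ρ(h)v = v:
ρ(λh)(ρ(λ'h)v) = ρ((λλ')h)v.
-/

open LieAlgebra.SpecialLinear

noncomputable section

/-- An additive map out of a field of characteristic different from two that is killed by two
vanishes. -/
theorem eq_zero_of_two_nsmul_eq_zero {K A : Type*} [Field K] [AddCommGroup A]
    (h2 : (2 : K) ≠ 0) (g : K →+ A) (hg : ∀ a, g a + g a = 0) (a : K) : g a = 0 := by
  rw [← hg (a / 2), ← map_add]
  congr 1
  field_simp
  ring

/-- Triples of additive families satisfying the relations of `sl₂` with `E a * E b = 0` satisfy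
`H b * E c = E (b * c)`. -/
theorem quadratic_mul_eq {K R : Type*} [Field K] [Ring R] (h2 : (2 : K) ≠ 0) (E F H : K →+ R)
    (hEE : ∀ a b, E a * E b = 0) (hEF : ∀ a b, E a * F b - F b * E a = H (a * b))
    (hHE : ∀ b c, H b * E c - E c * H b = E (b * c) + E (b * c)) (b c : K) :
    H b * E c = E (b * c) := by
  have key (a b c : K) : H (a * b) * E c = -(E a * H (b * c)) := by
    rw [← hEF a b, mul_comm b c, ← hEF c b, sub_mul, mul_sub, mul_assoc (F b), hEE, mul_zero,
      ← mul_assoc (E a) (E c), hEE, zero_mul, zero_sub, neg_neg, sub_zero, mul_assoc]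
  have one (d : K) : H d * E 1 = E d := by
    have := eq_zero_of_two_nsmul_eq_zero h2
      ((AddMonoidHom.mulRight (E 1)).comp H - E) (fun a ↦ ?_) d
    · exact sub_eq_zero.mp this
    · have h₁ := key 1 a 1
      have h₂ := hHE a 1
      simp only [one_mul, mul_one] at h₁ h₂
      simp only [AddMonoidHom.sub_apply, AddMonoidHom.comp_apply, AddMonoidHom.coe_mulRight]
      rw [← neg_eq_iff_eq_neg] at h₁
      rw [← h₁] at h₂
      calc _ = H a * E 1 - -(H a * E 1) - (E a + E a) := by abel
        _ = 0 := by rw [h₂, sub_self]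
  have h₁ := key 1 b c
  have h₂ := key 1 (b * c) 1
  simp only [one_mul, mul_one] at h₁ h₂
  rw [h₁, ← h₂, one]

/-- The brackets `[e, f]` and `[h, e]` of multiples of the standard basis vectors of `sl₂`. -/
theorem sl2_smul_bracket (K : Type*) [Field K] (a b : K) :
    ⁅a • sl2e K, b • sl2f K⁆ = (a * b) • sl2h K ∧
    ⁅a • sl2h K, b • sl2e K⁆ = (a * b) • sl2e K + (a * b) • sl2e K := by
  constructor <;> apply Subtype.ext <;> ext i j <;> fin_cases i <;> fin_cases j <;>
    simp [sl2e, sl2f, sl2h, Ring.lie_def, Matrix.mul_apply,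
      Matrix.single_apply, Matrix.vecMul, dotProduct] <;> ring

theorem stmt13 (K V : Type*) [Field K] (hchar : ringChar K ≠ 2) [AddCommGroup V]
    (ρ : sl2 K →+ AddMonoid.End V)
    (hbracket : ∀ x y : sl2 K, ρ ⁅x, y⁆ = ρ x * ρ y - ρ y * ρ x)
    (hquadE : ∀ lam mu : K, ρ (lam • sl2e K) * ρ (mu • sl2e K) = 0)
    (hquadF : ∀ lam mu : K, ρ (lam • sl2f K) * ρ (mu • sl2f K) = 0) :
    ∀ (lam lam' : K) (v : V), ρ (sl2h K) v = v →
      ρ (lam • sl2h K) (ρ (lam' • sl2h K) v) = ρ ((lam * lam') • sl2h K) v := by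
  have h2 : (2 : K) ≠ 0 := Ring.two_ne_zero hchar
  let r (x : sl2 K) : K →+ AddMonoid.End V := ρ.comp ((smulAddHom K (sl2 K)).flip x)
  have hEF (a b : K) : ρ (a • sl2e K) * ρ (b • sl2f K) - ρ (b • sl2f K) * ρ (a • sl2e K)
      = ρ ((a * b) • sl2h K) := by
    rw [← hbracket, (sl2_smul_bracket K a b).1]
  have hHE (a b : K) : ρ (a • sl2h K) * ρ (b • sl2e K) - ρ (b • sl2e K) * ρ (a • sl2h K)
      = ρ ((a * b) • sl2e K) + ρ ((a * b) • sl2e K) := by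
    rw [← hbracket, (sl2_smul_bracket K a b).2, map_add]
  have mulE (b c : K) : ρ (b • sl2h K) * ρ (c • sl2e K) = ρ ((b * c) • sl2e K) :=
    quadratic_mul_eq h2 (r (sl2e K)) (r (sl2f K)) (r (sl2h K)) hquadE hEF hHE b c
  intro l l' v hv
  have hE (a : K) : ρ (a • sl2e K) v = 0 := by
    refine eq_zero_of_two_nsmul_eq_zero h2
      ((AddMonoidHom.eval v).comp (r (sl2e K))) (fun a ↦ ?_) a
    change ρ (a • sl2e K) v + ρ (a • sl2e K) v = 0
    have hcomm := hHE 1 a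
    rw [mulE, one_mul, one_smul] at hcomm
    have hcomm_v : ρ (a • sl2e K) v - ρ (a • sl2e K) (ρ (sl2h K) v)
        = ρ (a • sl2e K) v + ρ (a • sl2e K) v := DFunLike.congr_fun hcomm v
    rw [← hcomm_v, hv, sub_self]
  have hH (a b : K) : ρ ((a * b) • sl2h K) v = ρ (a • sl2e K) (ρ (b • sl2f K) v) := by
    rw [← hEF]
    change ρ (a • sl2e K) (ρ (b • sl2f K) v) - ρ (b • sl2f K) (ρ (a • sl2e K) v) = _
    rw [hE, map_zero, sub_zero]
  have hl' := hH l' 1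
  rw [mul_one] at hl'
  have hll' := hH (l * l') 1
  rw [mul_one] at hll'
  rw [hl', hll', ← mulE]
  rfl
end
end
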